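/- arXiv:math/0207206 — 4 statements merged into one kernel-verified Lean document; each statement's English description precedes it below -/
import Mathlib

section
/- In U_q[gl(m|n)], for all indices a ≠ b with 1 ≤ a, b ≤ m+n, the graded commutator of the raising/lowering generators E^a_b and E^b_a satisfies [E^a_b, E^b_a] = Δ_a^{-1} (K_a K_b^{-1} − K_a^{-1} K_b). -/
/-!
U_q[gl(m|n)]: the quantum superalgebra presented by generators and relations,
following Zhang (1993).  We work over the field ℚ(q) of rational functions.
-/

noncomputable section

/-- The base field ℚ(q) of rational functions in the indeterminate q. -/
abbrev Fq : Type := RatFunc ℚ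

/-- The indeterminate q. -/
def qq : Fq := RatFunc.X

/-- The ℤ₂-grading of an index: `[a] = 0` if `a ≤ m`, `[a] = 1` if `a > m`. -/
def gr (m a : ℕ) : ℕ := if a ≤ m then 0 else 1

/-- `q_a = q^{(-1)^{[a]}}`. -/
def qi (m a : ℕ) : Fq := if a ≤ m then qq else qq⁻¹

/-- `Δ = q - q⁻¹`. -/
def Δq : Fq := qq - qq⁻¹

/-- `Δ_a = (-1)^{[a]} Δ`. -/
def Δi (m a : ℕ) : Fq := (-1 : Fq) ^ gr m a * Δq

/-- Kronecker delta, as an integer. -/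
def δℤ (a b : ℕ) : ℤ := if a = b then 1 else 0

/-- The sign `(-1)^{[E^a_b][E^c_d]}`, where `[E^a_b] = [a] + [b] (mod 2)`. -/
def sgn (m a b c d : ℕ) : Fq := (-1 : Fq) ^ ((gr m a + gr m b) * (gr m c + gr m d))

/-- The quantum superalgebra `U_q[gl(m|n)]`: a unital associative ℚ(q)-algebra with
invertible Cartan generators `K a` (`1 ≤ a ≤ m+n`) and generators `E a b`
(simple ones for `|a-b| = 1`, nonsimple ones defined recursively for `|a-b| > 1`),
subject to the defining relations below. -/
structure UqGl (m n : ℕ) where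
  /-- the underlying carrier -/
  A : Type
  ringA : Ring A
  algA : Algebra Fq A
  /-- Cartan generators `K_a` -/
  K : ℕ → A
  /-- inverse Cartan generators `K_a⁻¹` -/
  Kinv : ℕ → A
  /-- generators `E^a_b` -/
  E : ℕ → ℕ → A
  /-- (i) the Cartan generators commute -/
  K_comm : ∀ a b, 1 ≤ a → a ≤ m + n → 1 ≤ b → b ≤ m + n →
    K a * K b = K b * K a
  /-- (i) `K_a K_a⁻¹ = 1` -/
  K_Kinv : ∀ a, 1 ≤ a → a ≤ m + n → K a * Kinv a = 1
  /-- (i) `K_a⁻¹ K_a = 1` -/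
  Kinv_K : ∀ a, 1 ≤ a → a ≤ m + n → Kinv a * K a = 1
  /-- (ii) `K_a E^b_{b+1} = q_a^{δ^a_b - δ^a_{b+1}} E^b_{b+1} K_a` -/
  K_E_raise : ∀ a b, 1 ≤ a → a ≤ m + n → 1 ≤ b → b + 1 ≤ m + n →
    K a * E b (b+1) = (qi m a ^ (δℤ a b - δℤ a (b+1))) • (E b (b+1) * K a)
  /-- (ii) `K_a E^{b+1}_b = q_a^{δ^a_{b+1} - δ^a_b} E^{b+1}_b K_a` -/
  K_E_lower : ∀ a b, 1 ≤ a → a ≤ m + n → 1 ≤ b → b + 1 ≤ m + n →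
    K a * E (b+1) b = (qi m a ^ (δℤ a (b+1) - δℤ a b)) • (E (b+1) b * K a)
  /-- (iii) `[E^a_{a+1}, E^{b+1}_b] = δ^a_b Δ_a⁻¹ (K_a K_{a+1}⁻¹ - K_a⁻¹ K_{a+1})` -/
  EF_rel : ∀ a b, 1 ≤ a → a + 1 ≤ m + n → 1 ≤ b → b + 1 ≤ m + n →
    E a (a+1) * E (b+1) b - sgn m a (a+1) (b+1) b • (E (b+1) b * E a (a+1)) =
      (if a = b then (Δi m a)⁻¹ else 0) • (K a * Kinv (a+1) - Kinv a * K (a+1))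
  /-- (iv) simple lowering generators commute when `|a-b| > 1` -/
  EE_lower : ∀ a b, 1 ≤ a → a + 1 ≤ m + n → 1 ≤ b → b + 1 ≤ m + n →
    (a + 1 < b ∨ b + 1 < a) →
    E (a+1) a * E (b+1) b = E (b+1) b * E (a+1) a
  /-- (iv) simple raising generators commute when `|a-b| > 1` -/
  EE_raise : ∀ a b, 1 ≤ a → a + 1 ≤ m + n → 1 ≤ b → b + 1 ≤ m + n →
    (a + 1 < b ∨ b + 1 < a) →
    E a (a+1) * E b (b+1) = E b (b+1) * E a (a+1)
  /-- (v) the square of the odd simple raising generator is zero -/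
  odd_raise_sq : E m (m+1) * E m (m+1) = 0
  /-- (v) the square of the odd simple lowering generator is zero -/
  odd_lower_sq : E (m+1) m * E (m+1) m = 0
  /-- (vi) Serre relation `E^{a+1}_a E^{a+2}_a = q_a E^{a+2}_a E^{a+1}_a`, `a ≠ m` -/
  serre1 : m ≠ 1 → n ≠ 1 → ∀ a, 1 ≤ a → a + 2 ≤ m + n → a ≠ m →
    E (a+1) a * E (a+2) a = qi m a • (E (a+2) a * E (a+1) a)
  /-- (vi) Serre relation `E^a_{a+1} E^a_{a+2} = q_a E^a_{a+2} E^a_{a+1}`, `a ≠ m` -/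
  serre2 : m ≠ 1 → n ≠ 1 → ∀ a, 1 ≤ a → a + 2 ≤ m + n → a ≠ m →
    E a (a+1) * E a (a+2) = qi m a • (E a (a+2) * E a (a+1))
  /-- (vi) Serre relation `E^{a+1}_{a-1} E^{a+1}_a = q_a E^{a+1}_a E^{a+1}_{a-1}`, `a ≠ m` -/
  serre3 : m ≠ 1 → n ≠ 1 → ∀ a, 2 ≤ a → a + 1 ≤ m + n → a ≠ m →
    E (a+1) (a-1) * E (a+1) a = qi m a • (E (a+1) a * E (a+1) (a-1))
  /-- (vi) Serre relation `E^{a-1}_{a+1} E^a_{a+1} = q_a E^a_{a+1} E^{a-1}_{a+1}`, `a ≠ m` -/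
  serre4 : m ≠ 1 → n ≠ 1 → ∀ a, 2 ≤ a → a + 1 ≤ m + n → a ≠ m →
    E (a-1) (a+1) * E a (a+1) = qi m a • (E a (a+1) * E (a-1) (a+1))
  /-- (vi) Serre relation `[E^{m+1}_m, E^{m+2}_{m-1}] = 0` -/
  serre5 : m ≠ 1 → n ≠ 1 →
    E (m+1) m * E (m+2) (m-1) -
      sgn m (m+1) m (m+2) (m-1) • (E (m+2) (m-1) * E (m+1) m) = 0
  /-- (vi) Serre relation `[E^m_{m+1}, E^{m-1}_{m+2}] = 0` -/
  serre6 : m ≠ 1 → n ≠ 1 →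
    E m (m+1) * E (m-1) (m+2) -
      sgn m m (m+1) (m-1) (m+2) • (E (m-1) (m+2) * E m (m+1)) = 0
  /-- the nonsimple generators: for any `c` strictly between `a` and `b`,
  `E^a_b = E^a_c E^c_b - q_c^{sign(a-b)} E^c_b E^a_c` -/
  nonsimple_def : ∀ a b c, 1 ≤ a → a ≤ m + n → 1 ≤ b → b ≤ m + n →
    ((a < c ∧ c < b) ∨ (b < c ∧ c < a)) →
    E a b = E a c * E c b - (if b < a then qi m c else (qi m c)⁻¹) • (E c b * E a c)

attribute [instance] UqGl.ringA UqGl.algA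

namespace UqGl

variable {m n : ℕ}

/-- The graded commutator `[E^a_b, E^c_d] = E^a_b E^c_d - (-1)^{[E^a_b][E^c_d]} E^c_d E^a_b`. -/
def br (U : UqGl m n) (a b c d : ℕ) : U.A :=
  U.E a b * U.E c d - sgn m a b c d • (U.E c d * U.E a b)

end UqGl

theorem qq_ne : qq ≠ 0 := RatFunc.X_ne_zero

theorem qi_ne (m a : ℕ) : qi m a ≠ 0 := by
  unfold qi; split_ifs
  · exact qq_ne
  · exact inv_ne_zero qq_ne

theorem Δq_ne : Δq ≠ 0 := by
  unfold Δq
  intro h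
  have h1 : qq * qq = 1 := by
    have h2 : qq = qq⁻¹ := sub_eq_zero.mp h
    nth_rewrite 2 [h2]
    exact mul_inv_cancel₀ qq_ne
  have h3 : (Polynomial.X * Polynomial.X : Polynomial ℚ) = 1 := by
    apply RatFunc.algebraMap_injective ℚ
    simpa [qq, RatFunc.algebraMap_X] using h1
  have := congrArg (Polynomial.eval 2) h3
  norm_num at this

theorem Δi_ne (m a : ℕ) : Δi m a ≠ 0 :=
  mul_ne_zero (pow_ne_zero _ (by norm_num)) Δq_ne

theorem qi_sub (m a : ℕ) : qi m a - (qi m a)⁻¹ = Δi m a := by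
  unfold qi Δi gr Δq; split_ifs <;> simp

/-- The purely algebraic induction step. -/
theorem step_alg {k R : Type} [Field k] [Ring R] [Algebra k R] (X e f F A A' B B' : R)
    (q p s1 s2 d1 d2 : k) (hd2 : d2 * (q - p) = 1)
    (hXf : X * f = f * X) (heF : e * F = F * e)
    (hXF : X * F = s1 • (F * X) + d1 • (A - A'))
    (hef : e * f = s2 • (f * e) + d2 • (B - B'))
    (qp : q * p = 1)
    (hAe : A * e = p • (e * A)) (hAf : A * f = q • (f * A))
    (hAe' : A' * e = q • (e * A')) (hAf' : A' * f = p • (f * A'))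
    (hBX : B * X = p • (X * B)) (hBF : B * F = q • (F * B))
    (hBX' : B' * X = q • (X * B')) (hBF' : B' * F = p • (F * B'))
    (c1 : B * A = A * B) (c2 : B * A' = A' * B)
    (c3 : B' * A = A * B') (c4 : B' * A' = A' * B') :
    (X * e - p • (e * X)) * (f * F - q • (F * f))
      - (s1 * s2) • ((f * F - q • (F * f)) * (X * e - p • (e * X)))
      = d1 • (A * B - A' * B') := by
  have aux : ∀ {x y z : R}, x * y = z → ∀ w, x * (y * w) = z * w := by
    intro x y z h w; rw [← mul_assoc, h]
  simp only [mul_sub, sub_mul, mul_add, add_mul, smul_mul_assoc, mul_smul_comm, smul_sub, smul_add,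
    smul_smul, mul_assoc, hXf, heF, hXF, hef, hAe, hAf, hAe', hAf', hBX, hBF, hBX', hBF',
    c1, c2, c3, c4, aux hXf, aux heF, aux hXF, aux hef, aux hAf, aux hAf',
     aux hBF, aux hBF']
  match_scalars <;> first | ring1 | skip
  · linear_combination s2 * d1 * (q - p) * qp
  · linear_combination d1 * hd2 + d1 * d2 * q * qp
  · linear_combination -p * d1 * d2 * qp
  · linear_combination d2 * s1 * (p - q) * qp
  · linear_combination -q * d1 * d2 * qp
  · linear_combination -d1 * hd2 + d1 * d2 * p * qp

/-- Scaling passes to `q`-commutators. -/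
theorem sc_comb {k R : Type} [Field k] [Ring R] [Algebra k R] {W Y e : R} {μ : k} (x y : k)
    (hY : W * Y = Y * W) (hs : W * e = μ • (e * W)) :
    W * (x • (Y * e) - y • (e * Y)) = μ • ((x • (Y * e) - y • (e * Y)) * W) := by
  have hY' : ∀ w, W * (Y * w) = Y * (W * w) := by
    intro w; rw [← mul_assoc, hY, mul_assoc]
  have hs' : ∀ w, W * (e * w) = μ • (e * (W * w)) := by
    intro w; rw [← mul_assoc, hs, smul_mul_assoc, mul_assoc]
  simp only [mul_sub, sub_mul, mul_smul_comm, smul_mul_assoc, mul_assoc, hs, hY, hY', hs']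
  module

section
variable {R : Type} [Ring R] [Algebra Fq R]

theorem sc_inv {W V e : R} {μ : Fq} (h1 : W * V = 1) (h2 : V * W = 1) (hμ : μ ≠ 0)
    (h : W * e = μ • (e * W)) : V * e = μ⁻¹ • (e * V) := by
  have h3 : e * V = μ • (V * e) := by
    calc e * V = V * (W * e) * V := by rw [← mul_assoc V, h2, one_mul]
      _ = μ • (V * e) := by rw [h]; simp [mul_assoc, h1]
  rw [h3, smul_smul, inv_mul_cancel₀ hμ, one_smul]

theorem sc_mul {W V e : R} {μ ν : Fq} (h1 : W * e = μ • (e * W)) (h2 : V * e = ν • (e * V)) :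
    (W * V) * e = (μ * ν) • (e * (W * V)) := by
  rw [mul_assoc, h2, mul_smul_comm, ← mul_assoc, h1, smul_mul_assoc, smul_smul, mul_assoc,
    mul_comm ν]

theorem comm_inv {W V e : R} (h1 : W * V = 1) (h2 : V * W = 1)
    (h : W * e = e * W) : V * e = e * V := by
  have := sc_inv (μ := 1) h1 h2 one_ne_zero (by simpa using h)
  simpa using this
end

namespace UqGl
variable {m n : ℕ} (U : UqGl m n)

theorem def_raise (a c : ℕ) (h1 : 1 ≤ a) (hac : a < c) (hc : c + 1 ≤ m + n) :
    U.E a (c+1) = U.E a c * U.E c (c+1) - (qi m c)⁻¹ • (U.E c (c+1) * U.E a c) := by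
  rw [U.nonsimple_def a (c+1) c h1 (by omega) (by omega) hc (by omega), if_neg (by omega)]

theorem def_lower (a c : ℕ) (h1 : 1 ≤ a) (hac : a < c) (hc : c + 1 ≤ m + n) :
    U.E (c+1) a = U.E (c+1) c * U.E c a - qi m c • (U.E c a * U.E (c+1) c) := by
  rw [U.nonsimple_def (c+1) a c (by omega) (by omega) h1 (by omega) (by omega), if_pos (by omega)]

theorem comm_raise (Y : U.A) (a c : ℕ) (h1 : 1 ≤ a) (hac : a < c) (hc : c ≤ m + n)
    (h : ∀ i, a ≤ i → i < c → Y * U.E i (i+1) = U.E i (i+1) * Y) :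
    Y * U.E a c = U.E a c * Y := by
  induction c, hac using Nat.le_induction with
  | base => exact h a le_rfl (by omega)
  | succ c hac ih =>
    have ih' := ih (by omega) (fun i h1 h2 => h i h1 (by omega))
    have h2 := h c (by omega) (by omega)
    rw [U.def_raise a c h1 (by omega) hc]
    have e1 : Commute Y (U.E a c) := ih'
    have e2 : Commute Y (U.E c (c+1)) := h2
    exact (e1.mul_right e2).sub_right ((e2.mul_right e1).smul_right _)

theorem comm_lower (Y : U.A) (a c : ℕ) (h1 : 1 ≤ a) (hac : a < c) (hc : c ≤ m + n)
    (h : ∀ i, a ≤ i → i < c → Y * U.E (i+1) i = U.E (i+1) i * Y) :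
    Y * U.E c a = U.E c a * Y := by
  induction c, hac using Nat.le_induction with
  | base => exact h a le_rfl (by omega)
  | succ c hac ih =>
    have ih' := ih (by omega) (fun i h1 h2 => h i h1 (by omega))
    have h2 := h c (by omega) (by omega)
    rw [U.def_lower a c h1 (by omega) hc]
    have e1 : Commute Y (U.E c a) := ih'
    have e2 : Commute Y (U.E (c+1) c) := h2
    exact (e2.mul_right e1).sub_right ((e1.mul_right e2).smul_right _)

theorem K_simple_raise (k i : ℕ) (hk : 1 ≤ k) (hk' : k ≤ m + n) (hi : 1 ≤ i) (hi' : i + 1 ≤ m + n)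
    (h1 : k ≠ i) (h2 : k ≠ i + 1) : U.K k * U.E i (i+1) = U.E i (i+1) * U.K k := by
  rw [U.K_E_raise k i hk hk' hi hi']; simp [δℤ, h1, h2]

theorem K_simple_lower (k i : ℕ) (hk : 1 ≤ k) (hk' : k ≤ m + n) (hi : 1 ≤ i) (hi' : i + 1 ≤ m + n)
    (h1 : k ≠ i) (h2 : k ≠ i + 1) : U.K k * U.E (i+1) i = U.E (i+1) i * U.K k := by
  rw [U.K_E_lower k i hk hk' hi hi']; simp [δℤ, h1, h2]

theorem K_top_raise (a c : ℕ) (h1 : 1 ≤ a) (hac : a < c) (hc : c ≤ m + n) :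
    U.K c * U.E a c = (qi m c)⁻¹ • (U.E a c * U.K c) := by
  obtain ⟨d, rfl⟩ : ∃ d, c = d + 1 := ⟨c - 1, by omega⟩
  have hs : U.K (d+1) * U.E d (d+1) = (qi m (d+1))⁻¹ • (U.E d (d+1) * U.K (d+1)) := by
    rw [U.K_E_raise (d+1) d (by omega) hc (by omega) hc]; simp [δℤ]
  rcases Nat.lt_succ_iff_lt_or_eq.mp hac with h | rfl
  · have hY : U.K (d+1) * U.E a d = (1:Fq) • (U.E a d * U.K (d+1)) := by
      rw [one_smul]
      exact U.comm_raise _ a d h1 h (by omega) fun i _ _ =>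
        U.K_simple_raise _ i (by omega) hc (by omega) (by omega) (by omega) (by omega)
    rw [U.def_raise a d h1 h hc]
    simpa using sc_comb 1 (qi m d)⁻¹ (by simpa using hY) hs
  · exact hs

theorem K_top_lower (a c : ℕ) (h1 : 1 ≤ a) (hac : a < c) (hc : c ≤ m + n) :
    U.K c * U.E c a = qi m c • (U.E c a * U.K c) := by
  obtain ⟨d, rfl⟩ : ∃ d, c = d + 1 := ⟨c - 1, by omega⟩
  have hs : U.K (d+1) * U.E (d+1) d = qi m (d+1) • (U.E (d+1) d * U.K (d+1)) := by
    rw [U.K_E_lower (d+1) d (by omega) hc (by omega) hc]; simp [δℤ]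
  rcases Nat.lt_succ_iff_lt_or_eq.mp hac with h | rfl
  · have hY : U.K (d+1) * U.E d a = U.E d a * U.K (d+1) := by
      exact U.comm_lower _ a d h1 h (by omega) fun i _ _ =>
        U.K_simple_lower _ i (by omega) hc (by omega) (by omega) (by omega) (by omega)
    rw [U.def_lower a d h1 h hc]
    have := sc_comb (-qi m d) (-1) hY hs
    have e : ∀ x y : U.A, -qi m d • x - (-1 : Fq) • y = y - qi m d • x := by
      intro x y; rw [neg_smul, neg_smul, one_smul]; abel
    rwa [e] at this
  · exact hs

theorem sgn_one (a b c d : ℕ) (h : (b ≤ m ∧ a ≤ m) ∨ (m < a ∧ m < b) ∨ (c ≤ m ∧ d ≤ m) ∨ (m < c ∧ m < d)) :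
    sgn m a b c d = 1 := by
  unfold sgn gr
  rcases h with ⟨h, h'⟩ | ⟨h, h'⟩ | ⟨h, h'⟩ | ⟨h, h'⟩ <;> split_ifs <;> first | omega | norm_num

theorem sgn_mul (a c : ℕ) (hac : a < c) :
    sgn m a (c+1) (c+1) a = sgn m a c c a * sgn m c (c+1) (c+1) c := by
  unfold sgn gr; split_ifs <;> first | omega | norm_num

theorem EF_comm (i j : ℕ) (hi : 1 ≤ i) (hi' : i + 1 ≤ m + n) (hj : 1 ≤ j) (hj' : j + 1 ≤ m + n)
    (hij : i ≠ j) : U.E i (i+1) * U.E (j+1) j = U.E (j+1) j * U.E i (i+1) := by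
  have h := U.EF_rel i j hi hi' hj hj'
  rw [if_neg hij, zero_smul, sgn_one _ _ _ _ (by omega), one_smul] at h
  exact sub_eq_zero.mp h

theorem main (a b : ℕ) (h1 : 1 ≤ a) (hab : a < b) (hb : b ≤ m + n) :
    U.br a b b a = (Δi m a)⁻¹ • (U.K a * U.Kinv b - U.Kinv a * U.K b) := by
  induction b, hab using Nat.le_induction with
  | base => simpa [br] using U.EF_rel a a h1 hb h1 hb
  | succ c hac ih =>
    have ih := ih (by omega)
    have hac : a < c := hac
    have hef := U.EF_rel c c (by omega) hb (by omega) hb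
    rw [if_pos rfl] at hef
    unfold br at ih ⊢
    rw [sub_eq_iff_eq_add'] at ih hef
    have hqc := qi_ne m c
    have Ka := U.K_Kinv a h1 (by omega)
    have Ka' := U.Kinv_K a h1 (by omega)
    have Kc := U.K_Kinv c (by omega) (by omega)
    have Kc' := U.Kinv_K c (by omega) (by omega)
    have Kb := U.K_Kinv (c+1) (by omega) (by omega)
    have Kb' := U.Kinv_K (c+1) (by omega) (by omega)
    have kac : Commute (U.K a) (U.K c) := U.K_comm a c h1 (by omega) (by omega) (by omega)
    have kab : Commute (U.K a) (U.K (c+1)) := U.K_comm a (c+1) h1 (by omega) (by omega) (by omega)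
    have kcb : Commute (U.K c) (U.K (c+1)) :=
      U.K_comm c (c+1) (by omega) (by omega) (by omega) (by omega)
    have ka_e : U.K a * U.E c (c+1) = (1:Fq) • (U.E c (c+1) * U.K a) := by
      rw [one_smul]
      exact U.K_simple_raise a c h1 (by omega) (by omega) hb (by omega) (by omega)
    have ka_f : U.K a * U.E (c+1) c = (1:Fq) • (U.E (c+1) c * U.K a) := by
      rw [one_smul]
      exact U.K_simple_lower a c h1 (by omega) (by omega) hb (by omega) (by omega)
    have kc_e : U.K c * U.E c (c+1) = qi m c • (U.E c (c+1) * U.K c) := by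
      rw [U.K_E_raise c c (by omega) (by omega) (by omega) hb]; simp [δℤ]
    have kc_f : U.K c * U.E (c+1) c = (qi m c)⁻¹ • (U.E (c+1) c * U.K c) := by
      rw [U.K_E_lower c c (by omega) (by omega) (by omega) hb]; simp [δℤ]
    have kb_X : U.K (c+1) * U.E a c = (1:Fq) • (U.E a c * U.K (c+1)) := by
      rw [one_smul]
      exact U.comm_raise _ a c h1 hac (by omega) fun i _ _ =>
        U.K_simple_raise _ i (by omega) hb (by omega) (by omega) (by omega) (by omega)
    have kb_F : U.K (c+1) * U.E c a = (1:Fq) • (U.E c a * U.K (c+1)) := by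
      rw [one_smul]
      exact U.comm_lower _ a c h1 hac (by omega) fun i _ _ =>
        U.K_simple_lower _ i (by omega) hb (by omega) (by omega) (by omega) (by omega)
    have kc_X := U.K_top_raise a c h1 hac (by omega)
    have kc_F := U.K_top_lower a c h1 hac (by omega)
    have Cinv : ∀ {x y z : U.A}, x * y = 1 → y * x = 1 → Commute x z → Commute y z :=
      fun h1 h2 h => comm_inv h1 h2 h
    have iac : Commute (U.Kinv a) (U.K c) := Cinv Ka Ka' kac
    have iab : Commute (U.Kinv a) (U.K (c+1)) := Cinv Ka Ka' kab
    have aic : Commute (U.K a) (U.Kinv c) := (Cinv Kc Kc' kac.symm).symm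
    have aib : Commute (U.K a) (U.Kinv (c+1)) := (Cinv Kb Kb' kab.symm).symm
    have iaic : Commute (U.Kinv a) (U.Kinv c) := Cinv Ka Ka' aic
    have iaib : Commute (U.Kinv a) (U.Kinv (c+1)) := Cinv Ka Ka' aib
    have icb : Commute (U.Kinv c) (U.K (c+1)) := Cinv Kc Kc' kcb
    have cib : Commute (U.K c) (U.Kinv (c+1)) := (Cinv Kb Kb' kcb.symm).symm
    have icib : Commute (U.Kinv c) (U.Kinv (c+1)) := Cinv Kc Kc' cib
    have cic : Commute (U.K c) (U.Kinv c) := by rw [Commute, SemiconjBy, Kc, Kc']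
    have key := step_alg (U.E a c) (U.E c (c+1)) (U.E (c+1) c) (U.E c a)
      (U.K a * U.Kinv c) (U.Kinv a * U.K c) (U.K c * U.Kinv (c+1)) (U.Kinv c * U.K (c+1))
      (qi m c) (qi m c)⁻¹ (sgn m a c c a) (sgn m c (c+1) (c+1) c) (Δi m a)⁻¹ (Δi m c)⁻¹
      (by rw [qi_sub]; exact inv_mul_cancel₀ (Δi_ne m c))
      (U.comm_raise _ a c h1 hac (by omega) fun i _ _ =>
        (U.EF_comm i c (by omega) (by omega) (by omega) hb (by omega)).symm).symm
      (U.comm_lower _ a c h1 hac (by omega) fun i _ _ =>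
        U.EF_comm c i (by omega) hb (by omega) (by omega) (by omega))
      ih hef (mul_inv_cancel₀ hqc)
      (by simpa using sc_mul ka_e (sc_inv Kc Kc' hqc kc_e))
      (by simpa using sc_mul ka_f (sc_inv Kc Kc' (inv_ne_zero hqc) kc_f))
      (by simpa using sc_mul (sc_inv Ka Ka' one_ne_zero ka_e) kc_e)
      (by simpa using sc_mul (sc_inv Ka Ka' one_ne_zero ka_f) kc_f)
      (by simpa using sc_mul kc_X (sc_inv Kb Kb' one_ne_zero kb_X))
      (by simpa using sc_mul kc_F (sc_inv Kb Kb' one_ne_zero kb_F))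
      (by simpa using sc_mul (sc_inv Kc Kc' (inv_ne_zero hqc) kc_X) kb_X)
      (by simpa using sc_mul (sc_inv Kc Kc' hqc kc_F) kb_F)
      ((kac.symm.mul_right cic).mul_left (aib.symm.mul_right icib.symm))
      ((iac.symm.mul_right (Commute.refl _)).mul_left (iaib.symm.mul_right cib.symm))
      ((aic.symm.mul_right (Commute.refl _)).mul_left (kab.symm.mul_right icb.symm))
      ((iaic.symm.mul_right cic.symm).mul_left (iab.symm.mul_right kcb.symm))
    rw [U.def_raise a c h1 hac hb, U.def_lower a c h1 hac hb, sgn_mul a c hac, key]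
    have z1 : U.K a * U.Kinv c * (U.K c * U.Kinv (c+1)) = U.K a * U.Kinv (c+1) := by
      rw [mul_assoc, ← mul_assoc (U.Kinv c), Kc', one_mul]
    have z2 : U.Kinv a * U.K c * (U.Kinv c * U.K (c+1)) = U.Kinv a * U.K (c+1) := by
      rw [mul_assoc, ← mul_assoc (U.K c), Kc, one_mul]
    rw [z1, z2]

end UqGl

theorem stmt0 (m n : ℕ) (hm : 1 ≤ m) (hn : 1 ≤ n) (U : UqGl m n)
    (a b : ℕ)
    (h1 : 1 ≤ a) (h2 : a ≤ m + n) (h3 : 1 ≤ b) (h4 : b ≤ m + n) (hab : a ≠ b) :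
    U.br a b b a = (Δi m a)⁻¹ • (U.K a * U.Kinv b - U.Kinv a * U.K b) := by
  rcases lt_or_gt_of_ne hab with h | h
  · exact U.main a b h1 h h4
  · have key := U.main b a h3 h h2
    have k : Commute (U.K a) (U.K b) := U.K_comm a b h1 h2 h3 h4
    have e1 : U.K b * U.Kinv a = U.Kinv a * U.K b :=
      (comm_inv (U.K_Kinv a h1 h2) (U.Kinv_K a h1 h2) k).symm
    have e2 : U.Kinv b * U.K a = U.K a * U.Kinv b :=
      comm_inv (U.K_Kinv b h3 h4) (U.Kinv_K b h3 h4) k.symm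
    rw [e1, e2] at key
    unfold UqGl.br at key ⊢
    have key' := sub_eq_iff_eq_add'.mp key
    rw [key', smul_add, smul_smul, smul_smul]
    have s1 : sgn m a b b a * sgn m b a a b = 1 := by
      unfold sgn gr; split_ifs <;> norm_num
    have s2 : sgn m a b b a * (Δi m b)⁻¹ = (Δi m a)⁻¹ := by
      unfold sgn gr Δi gr; split_ifs <;> simp [inv_neg, Even.neg_one_pow (show Even 4 by decide)]
    rw [s1, s2, one_smul, smul_sub, smul_sub]
    abel

end
end

section
/- In U_q[gl(m|n)], for indices with c < b < a, the graded commutator satisfies [E^a_c, E^c_b] = K_b^{-1} K_c E^a_b. -/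
/-!
U_q[gl(m|n)]: the quantum superalgebra presented by generators and relations,
following Zhang (1993).  We work over the field ℚ(q) of rational functions.
-/

noncomputable section

namespace UqAux

/-- abstract computation for the base case -/
lemma base_alg {k A : Type*} [Field k] [Ring A] [Algebra k A] (F1 F2 E1 K L : A) (s δ q : k)
    (hs : s * s = 1) (hq : q ≠ 0) (hδ : s * δ * (q - q⁻¹) = 1)
    (h1 : E1 * F1 - s • (F1 * E1) = δ • (K - L))
    (h2 : F2 * E1 = E1 * F2)
    (h3 : K * F2 = q • (F2 * K)) (h4 : L * F2 = q⁻¹ • (F2 * L)) :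
    (F2 * F1 - q • (F1 * F2)) * E1 - s • (E1 * (F2 * F1 - q • (F1 * F2))) = K * F2 := by
  have h1' : F1 * E1 = s • (E1 * F1) - (s * δ) • (K - L) := by
    have : s • (E1 * F1 - s • (F1 * E1)) = s • (δ • (K - L)) := by rw [h1]
    rw [smul_sub, smul_smul, hs, one_smul, smul_smul] at this
    rw [← this]; abel
  have e1 : F2 * F1 * E1 = s • (E1 * (F2 * F1)) - (s * δ) • (F2 * K - F2 * L) := by
    rw [mul_assoc, h1', mul_sub, mul_smul_comm, mul_smul_comm, ← mul_assoc, h2, mul_assoc, mul_sub]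
  have e2 : F1 * F2 * E1 = s • (E1 * (F1 * F2)) - (s * δ) • (K * F2 - L * F2) := by
    rw [mul_assoc, h2, ← mul_assoc, h1', sub_mul, smul_mul_assoc, smul_mul_assoc, mul_assoc,
      sub_mul]
  have h3' : F2 * K = q⁻¹ • (K * F2) := by rw [h3, smul_smul, inv_mul_cancel₀ hq, one_smul]
  have h4' : F2 * L = q • (L * F2) := by rw [h4, smul_smul, mul_inv_cancel₀ hq, one_smul]
  have : K * F2 = (s * δ * (q - q⁻¹)) • (K * F2) := by rw [hδ, one_smul]
  rw [this, sub_mul, smul_mul_assoc, e1, e2, h3', h4', mul_sub, mul_smul_comm]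
  module

/-- abstract computation for the induction step -/
lemma step_alg {k A : Type*} [Field k] [Ring A] [Algebra k A] (G e C X P Z : A) (s1 s2 q : k)
    (hq : q ≠ 0)
    (h1 : G * e = s1 • (e * G))
    (h2 : G * C - s2 • (C * G) = P * X)
    (h3 : P * e = q⁻¹ • (e * P))
    (h4 : X * e - s1 • (e * X) = Z) :
    G * (C * e - q⁻¹ • (e * C)) - (s1 * s2) • ((C * e - q⁻¹ • (e * C)) * G) = P * Z := by
  have h2' : G * C = s2 • (C * G) + P * X := by rw [← h2]; abel
  have e1 : G * (C * e) = (s1 * s2) • (C * e * G) + P * X * e := by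
    rw [← mul_assoc, h2', add_mul, smul_mul_assoc, mul_assoc C, h1, mul_smul_comm, smul_smul,
      mul_comm s2, mul_assoc C]
  have e2 : G * (e * C) = (s1 * s2) • (e * C * G) + s1 • (e * (P * X)) := by
    rw [← mul_assoc, h1, smul_mul_assoc, mul_assoc, h2', mul_add, mul_smul_comm, smul_add,
      smul_smul, mul_assoc e]
  have h3' : e * (P * X) = q • (P * (e * X)) := by
    rw [← mul_assoc P, h3, smul_mul_assoc, smul_smul, mul_inv_cancel₀ hq, one_smul, mul_assoc]
  rw [← h4, mul_sub, mul_smul_comm, e1, e2, h3', sub_mul, smul_mul_assoc, mul_sub, mul_smul_comm,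
    mul_assoc P X e]
  match_scalars <;> field_simp <;> ring

lemma inv_swap {k A : Type*} [Field k] [Ring A] [Algebra k A] (K L X : A) (t : k)
    (ht : t ≠ 0) (h1 : K * L = 1) (h2 : L * K = 1) (h : K * X = t • (X * K)) :
    L * X = t⁻¹ • (X * L) := by
  have e : X * K = t⁻¹ • (K * X) := by rw [h, smul_smul, inv_mul_cancel₀ ht, one_smul]
  calc L * X = L * (X * K) * L := by rw [mul_assoc L, mul_assoc X, h1, mul_one]
    _ = t⁻¹ • (X * L) := by
      rw [e, mul_smul_comm, ← mul_assoc, h2, one_mul, smul_mul_assoc]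

lemma swap_mul {k A : Type*} [Field k] [Ring A] [Algebra k A] (K L X : A) (t u : k)
    (h1 : K * X = t • (X * K)) (h2 : L * X = u • (X * L)) :
    (K * L) * X = (t * u) • (X * (K * L)) := by
  rw [mul_assoc, h2, mul_smul_comm, ← mul_assoc, h1, smul_mul_assoc, smul_smul, mul_comm u,
    mul_assoc]

lemma qq_ne : qq ≠ 0 := RatFunc.X_ne_zero

lemma qi_ne (m a : ℕ) : qi m a ≠ 0 := by
  unfold qi; split_ifs
  · exact qq_ne
  · exact inv_ne_zero qq_ne

lemma Δq_ne : Δq ≠ 0 := by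
  intro h
  have h2 : qq * qq = 1 := by
    have : qq = qq⁻¹ := sub_eq_zero.mp h
    nth_rewrite 2 [this]
    exact mul_inv_cancel₀ qq_ne
  have h3 : (Polynomial.X * Polynomial.X : Polynomial ℚ) = 1 := by
    apply RatFunc.algebraMap_injective ℚ
    rw [map_mul, map_one, RatFunc.algebraMap_X]
    exact h2
  have := congrArg (Polynomial.eval 0) h3
  simp at this

lemma sgn_one_of (m a b c d : ℕ) (h : gr m a = gr m b ∨ gr m c = gr m d) :
    sgn m a b c d = 1 := by
  unfold sgn
  rcases h with h | h
  · rw [h, ← two_mul, mul_assoc, pow_mul]; simp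
  · rw [h, ← two_mul, mul_left_comm, pow_mul]; simp

lemma gr_disj (m a b c d : ℕ) (h1 : a ≤ b) (h2 : b ≤ c) (h3 : c ≤ d) :
    gr m a = gr m b ∨ gr m c = gr m d := by
  unfold gr; split_ifs <;> omega

variable {m n : ℕ} (U : UqGl m n)

/-- Cartan weights of lowering root vectors. -/
lemma K_low (i b : ℕ) (hi : 1 ≤ i) (hi' : i ≤ m + n) (hb : 1 ≤ b) (a : ℕ) (hab : b + 1 ≤ a)
    (ha : a ≤ m + n) :
    U.K i * U.E a b = (qi m i ^ (δℤ i a - δℤ i b)) • (U.E a b * U.K i) := by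
  induction a, hab using Nat.le_induction with
  | base => exact U.K_E_lower i b hi hi' hb ha
  | succ a hab ih =>
    have ih := ih (by omega)
    have h := U.K_E_lower i a hi hi' (by omega) ha
    rw [U.nonsimple_def (a+1) b a (by omega) ha hb (by omega) (Or.inr ⟨by omega, by omega⟩)]
    generalize U.E (a+1) a = x at *
    generalize U.E a b = y at *
    have e : qi m i ^ (δℤ i (a+1) - δℤ i b)
        = qi m i ^ (δℤ i (a+1) - δℤ i a) * qi m i ^ (δℤ i a - δℤ i b) := by
      rw [← zpow_add₀ (qi_ne m i)]; congr 1; ring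
    rw [e]
    generalize qi m i ^ (δℤ i (a+1) - δℤ i a) = t at *
    generalize qi m i ^ (δℤ i a - δℤ i b) = u at *
    have e1 : U.K i * (x * y) = (t * u) • (x * y * U.K i) := by
      rw [← mul_assoc, h, smul_mul_assoc, mul_assoc, ih, mul_smul_comm, smul_smul, mul_assoc]
    have e2 : U.K i * (y * x) = (t * u) • (y * x * U.K i) := by
      rw [← mul_assoc, ih, smul_mul_assoc, mul_assoc, h, mul_smul_comm, smul_smul, mul_assoc,
        mul_comm u]
    rw [mul_sub, mul_smul_comm, e1, e2, sub_mul, smul_mul_assoc, smul_sub, smul_comm]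

/-- Lowering root vectors commute with simple raising generators outside their range. -/
lemma low_raise_comm (b d : ℕ) (hb : 1 ≤ b) (hd : 1 ≤ d) (hd' : d + 1 ≤ m + n) (a : ℕ)
    (hab : b + 1 ≤ a) (ha : a ≤ m + n) (h : d + 1 ≤ b ∨ a ≤ d) :
    Commute (U.E a b) (U.E d (d+1)) := by
  have simp_case : ∀ c, 1 ≤ c → c + 1 ≤ m + n → (d + 1 ≤ c ∨ c + 1 ≤ d) →
      Commute (U.E (c+1) c) (U.E d (d+1)) := by
    intro c hc hc' hcd
    have h := U.EF_rel d c hd hd' hc hc'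
    have hs : sgn m d (d+1) (c+1) c = 1 := by
      apply sgn_one_of
      unfold gr; split_ifs <;> omega
    rw [hs, if_neg (by omega), one_smul, zero_smul] at h
    exact (sub_eq_zero.mp h).symm
  induction a, hab using Nat.le_induction with
  | base => exact simp_case b hb ha h
  | succ a hab ih =>
    have ih := ih (by omega) (by omega)
    have h := simp_case a (by omega) ha (by omega)
    rw [U.nonsimple_def (a+1) b a (by omega) ha hb (by omega) (Or.inr ⟨by omega, by omega⟩)]
    exact (h.mul_left ih).sub_left ((ih.mul_left h).smul_left _)

lemma low_low_simple (b d : ℕ) (hd : 1 ≤ d) (hdb : d + 1 < b) (a : ℕ)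
    (hab : b + 1 ≤ a) (ha : a ≤ m + n) :
    Commute (U.E a b) (U.E (d+1) d) := by
  induction a, hab using Nat.le_induction with
  | base => exact U.EE_lower b d (by omega) ha hd (by omega) (by omega)
  | succ a hab ih =>
    have ih := ih (by omega)
    have h : Commute (U.E (a+1) a) (U.E (d+1) d) :=
      U.EE_lower a d (by omega) ha hd (by omega) (by omega)
    rw [U.nonsimple_def (a+1) b a (by omega) ha (by omega) (by omega)
      (Or.inr ⟨by omega, by omega⟩)]
    exact (h.mul_left ih).sub_left ((ih.mul_left h).smul_left _)

lemma low_low (a b c : ℕ) (hc : 1 ≤ c) (hab : b + 1 ≤ a) (ha : a ≤ m + n) (d : ℕ)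
    (hcd : c + 1 ≤ d) (hdb : d < b) :
    Commute (U.E a b) (U.E d c) := by
  induction d, hcd using Nat.le_induction with
  | base => exact low_low_simple U b c hc hdb a hab ha
  | succ d hcd ih =>
    have ih := ih (by omega)
    have h := low_low_simple U b d (by omega) hdb a hab ha
    rw [U.nonsimple_def (d+1) c d (by omega) (by omega) hc (by omega)
      (Or.inr ⟨by omega, by omega⟩)]
    exact (h.mul_right ih).sub_right ((ih.mul_right h).smul_right _)

lemma scal (m c b : ℕ) :
    (-1 : Fq) ^ ((gr m c + gr m b)) * (Δi m c)⁻¹ * (qi m b - (qi m b)⁻¹) = 1 := by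
  have h := Δq_ne
  have e : qi m b - (qi m b)⁻¹ = (-1) ^ gr m b * Δq := by
    unfold qi gr Δq
    split_ifs <;> simp
  have s : ∀ k : ℕ, ((-1 : Fq) ^ k) * (-1) ^ k = 1 := by
    intro k; rw [← mul_pow]; simp
  have hc : ((-1 : Fq) ^ gr m c) ≠ 0 := pow_ne_zero _ (by simp)
  rw [e, Δi, pow_add]
  field_simp
  rw [sq]; exact s _

lemma Kinv_comm (a b : ℕ) (h1 : 1 ≤ a) (h2 : a ≤ m + n) (h3 : 1 ≤ b) (h4 : b ≤ m + n) :
    Commute (U.Kinv a) (U.K b) := by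
  have h := inv_swap (k := Fq) (U.K a) (U.Kinv a) (U.K b) 1 one_ne_zero (U.K_Kinv a h1 h2)
    (U.Kinv_K a h1 h2) (by rw [one_smul]; exact U.K_comm a b h1 h2 h3 h4)
  rw [inv_one, one_smul] at h
  exact h

lemma Kinv_Kinv_comm (a b : ℕ) (h1 : 1 ≤ a) (h2 : a ≤ m + n) (h3 : 1 ≤ b) (h4 : b ≤ m + n) :
    Commute (U.Kinv a) (U.Kinv b) := by
  have h := inv_swap (k := Fq) (U.K a) (U.Kinv a) (U.Kinv b) 1 one_ne_zero (U.K_Kinv a h1 h2)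
    (U.Kinv_K a h1 h2) (by rw [one_smul]; exact (Kinv_comm U b a h3 h4 h1 h2).symm)
  rw [inv_one, one_smul] at h
  exact h

/-- The base case `b = c + 1`. -/
lemma base_case (a c : ℕ) (hc : 1 ≤ c) (hac : c + 1 < a) (ha : a ≤ m + n) :
    U.E a c * U.E c (c+1) - sgn m a c c (c+1) • (U.E c (c+1) * U.E a c)
      = U.Kinv (c+1) * U.K c * U.E a (c+1) := by
  have hs : sgn m a c c (c+1) = (-1 : Fq) ^ (gr m c + gr m (c+1)) := by
    unfold sgn gr; split_ifs <;> first | omega | norm_num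
  have hs' : sgn m c (c+1) (c+1) c = (-1 : Fq) ^ (gr m c + gr m (c+1)) := by
    unfold sgn gr; split_ifs <;> first | omega | norm_num
  have h1 := U.EF_rel c c hc (by omega) hc (by omega)
  rw [if_pos rfl, hs'] at h1
  have h2 := low_raise_comm U (c+1) c (by omega) hc (by omega) a (by omega) ha (by omega)
  have k1 := K_low U c (c+1) hc (by omega) (by omega) a (by omega) ha
  have k2 := K_low U (c+1) (c+1) (by omega) (by omega) (by omega) a (by omega) ha
  have d1 : δℤ c a - δℤ c (c+1) = 0 := by
    unfold δℤ; rw [if_neg (by omega), if_neg (by omega)]; rfl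
  have d2 : δℤ (c+1) a - δℤ (c+1) (c+1) = -1 := by
    unfold δℤ; rw [if_neg (by omega), if_pos rfl]; rfl
  rw [d1, zpow_zero] at k1
  rw [d2, zpow_neg_one] at k2
  have k1' := inv_swap _ (U.Kinv c) _ _ one_ne_zero (U.K_Kinv c hc (by omega))
    (U.Kinv_K c hc (by omega)) k1
  have k2' := inv_swap _ (U.Kinv (c+1)) _ _ (inv_ne_zero (qi_ne m (c+1)))
    (U.K_Kinv (c+1) (by omega) (by omega)) (U.Kinv_K (c+1) (by omega) (by omega)) k2
  have h3 := swap_mul _ _ _ _ _ k1 k2'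
  have h4 := swap_mul _ _ _ _ _ k1' k2
  rw [one_mul, inv_inv] at h3
  rw [inv_one, one_mul] at h4
  rw [hs, U.nonsimple_def a c (c+1) (by omega) ha hc (by omega) (Or.inr ⟨by omega, hac⟩),
    if_pos (by omega)]
  rw [base_alg _ _ _ _ _ _ _ _ (by rw [← mul_pow]; simp) (qi_ne m (c+1)) (scal m c (c+1))
    h1 h2 h3 h4, (Kinv_comm U (c+1) c (by omega) (by omega) hc (by omega)).eq]

/-- `E^a_c` graded-commutes with inner simple raising generators. -/
lemma inner_comm (a c d : ℕ) (hc : 1 ≤ c) (hcd : c < d) (hda : d + 1 < a) (ha : a ≤ m + n) :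
    U.E a c * U.E d (d+1) = sgn m a d d (d+1) • (U.E d (d+1) * U.E a c) := by
  have hb := base_case U a d (by omega) hda ha
  have h2 := (low_raise_comm U c d hc (by omega) (by omega) d hcd (by omega) (by omega)).eq
  have h3 := (low_low U a (d+1) c hc hda ha d hcd (by omega)).eq
  have k1 := K_low U d c (by omega) (by omega) hc d hcd (by omega)
  have k2 := K_low U (d+1) c (by omega) (by omega) hc d hcd (by omega)
  have d1 : δℤ d d - δℤ d c = 1 := by
    unfold δℤ; rw [if_pos rfl, if_neg (by omega)]; rfl
  have d2 : δℤ (d+1) d - δℤ (d+1) c = 0 := by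
    unfold δℤ; rw [if_neg (by omega), if_neg (by omega)]; rfl
  rw [d1, zpow_one] at k1
  rw [d2, zpow_zero] at k2
  have k2' := inv_swap _ (U.Kinv (d+1)) _ _ one_ne_zero
    (U.K_Kinv (d+1) (by omega) (by omega)) (U.Kinv_K (d+1) (by omega) (by omega)) k2
  have hP := swap_mul _ _ _ _ _ k2' k1
  rw [inv_one, one_mul] at hP
  rw [U.nonsimple_def a c d (by omega) ha hc (by omega) (Or.inr ⟨hcd, by omega⟩),
    if_pos (by omega)]
  generalize U.Kinv (d+1) * U.K d = P at *
  generalize U.E a (d+1) = X at *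
  generalize U.E d c = F at *
  generalize U.E a d = Y at *
  generalize U.E d (d+1) = e at *
  generalize sgn m a d d (d+1) = s at *
  generalize qi m d = q at *
  have hb' : Y * e = s • (e * Y) + P * X := by rw [← hb]; abel
  have e1 : Y * F * e = s • (e * (Y * F)) + P * X * F := by
    rw [mul_assoc, h2, ← mul_assoc, hb', add_mul, smul_mul_assoc, mul_assoc]
  have e2 : F * Y * e = s • (e * (F * Y)) + F * (P * X) := by
    rw [mul_assoc, hb', mul_add, mul_smul_comm, ← mul_assoc, h2, mul_assoc]
  have e3 : P * X * F = q • (F * (P * X)) := by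
    rw [mul_assoc, h3, ← mul_assoc, hP, smul_mul_assoc, mul_assoc]
  rw [sub_mul, smul_mul_assoc, e1, e2, e3, mul_sub, mul_smul_comm, smul_sub, smul_add, smul_comm q s]
  abel

lemma main_aux (a c : ℕ) (hc : 1 ≤ c) (ha : a ≤ m + n) (b : ℕ) (hcb : c + 1 ≤ b) (hba : b < a) :
    U.E a c * U.E c b - sgn m a c c b • (U.E c b * U.E a c)
      = U.Kinv b * U.K c * U.E a b := by
  induction b, hcb using Nat.le_induction with
  | base => exact base_case U a c hc hba ha
  | succ d hcd ih =>
    have ih := ih (by omega)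
    have h1 := inner_comm U a c d hc hcd hba ha
    have h4 := base_case U a d (by omega) hba ha
    have k1 := U.K_E_raise d d (by omega) (by omega) (by omega) (by omega)
    have k2 := U.K_E_raise c d hc (by omega) (by omega) (by omega)
    have d1 : δℤ d d - δℤ d (d+1) = 1 := by
      unfold δℤ; rw [if_pos rfl, if_neg (by omega)]; rfl
    have d2 : δℤ c d - δℤ c (d+1) = 0 := by
      unfold δℤ; rw [if_neg (by omega), if_neg (by omega)]; rfl
    rw [d1, zpow_one] at k1
    rw [d2, zpow_zero] at k2
    have k1' := inv_swap _ (U.Kinv d) _ _ (qi_ne m d)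
      (U.K_Kinv d (by omega) (by omega)) (U.Kinv_K d (by omega) (by omega)) k1
    have hP := swap_mul _ _ _ _ _ k1' k2
    rw [mul_one] at hP
    have hs : sgn m a c c (d+1) = sgn m a d d (d+1) * sgn m a c c d := by
      unfold sgn gr; split_ifs <;> first | omega | norm_num
    rw [hs, U.nonsimple_def c (d+1) d hc (by omega) (by omega) (by omega)
      (Or.inl ⟨by omega, by omega⟩), if_neg (by omega),
      step_alg _ _ _ _ _ _ _ _ _ (qi_ne m d) h1 ih hP h4]
    have c1 := (Kinv_comm U (d+1) c (by omega) (by omega) hc (by omega)).eq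
    have c2 := (Kinv_comm U (d+1) d (by omega) (by omega) (by omega) (by omega)).eq
    have c3 := (Kinv_comm U d c (by omega) (by omega) hc (by omega)).eq
    rw [← mul_assoc]
    congr 1
    rw [c2, c3, mul_assoc, ← mul_assoc (U.Kinv d), U.Kinv_K d (by omega) (by omega), one_mul, c1]

end UqAux

theorem stmt1 (m n : ℕ) (hm : 1 ≤ m) (hn : 1 ≤ n) (U : UqGl m n)
    (a b c : ℕ)
    (h1 : 1 ≤ a) (h2 : a ≤ m + n) (h3 : 1 ≤ b) (h4 : b ≤ m + n)
    (h5 : 1 ≤ c) (h6 : c ≤ m + n)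
    (hcb : c < b) (hba : b < a) :
    U.br a c c b = U.Kinv b * U.K c * U.E a b := by
  exact UqAux.main_aux U a c h5 h2 b hcb hba

end
end

section
/- In U_q[gl(m|n)], if the index c lies strictly between the indices a and b (that is, a < c < b or b < c < a), then the graded commutators [E^c_a, E^c_b] and [E^a_c, E^b_c] both vanish. -/
/-!
U_q[gl(m|n)]: the quantum superalgebra presented by generators and relations,
following Zhang (1993).  We work over the field ℚ(q) of rational functions.
-/

noncomputable section

theorem sgn_split (m a b c d e : ℕ) : sgn m a b c d = sgn m a b c e * sgn m a b e d := by
  unfold sgn gr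
  split_ifs <;> norm_num

theorem sgn_symm (m a b c d : ℕ) : sgn m a b c d = sgn m c d a b := by
  unfold sgn
  rw [mul_comm]

theorem sgn_sq (m a b c d : ℕ) : sgn m a b c d * sgn m a b c d = 1 := by
  unfold sgn
  rw [← mul_pow]
  simp

/-- If `x` commutes up to scalars with `y` and `z`, it does so with `y z - r z y`. -/
theorem scomm_aux {A : Type} [Ring A] [Algebra Fq A] (x y z : A) (s t r : Fq)
    (hy : x * y = s • (y * x)) (hz : x * z = t • (z * x)) :
    x * (y * z - r • (z * y)) = (s * t) • ((y * z - r • (z * y)) * x) := by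
  have e1 : x * (y * z) = (s * t) • (y * z * x) := by
    rw [← mul_assoc, hy, smul_mul_assoc, mul_assoc, hz, mul_smul_comm, smul_smul, mul_assoc]
  have e2 : x * (z * y) = (s * t) • (z * y * x) := by
    rw [← mul_assoc, hz, smul_mul_assoc, mul_assoc, hy, mul_smul_comm, smul_smul, mul_assoc,
      mul_comm t s]
  rw [mul_sub, mul_smul_comm, e1, e2, sub_mul, smul_mul_assoc, smul_sub, smul_comm r]

namespace UqGl

variable {m n : ℕ}

theorem br_symm (U : UqGl m n) (a b c d : ℕ) (h : U.br a b c d = 0) : U.br c d a b = 0 := by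
  unfold br at *
  rw [sub_eq_zero] at *
  rw [h, smul_smul, sgn_symm m c d a b, sgn_sq, one_smul]

/-- Splitting the second generator at an intermediate index. -/
theorem br_split (U : UqGl m n) (x y a b c : ℕ) (h1 : 1 ≤ a) (h2 : a ≤ m + n) (h3 : 1 ≤ b)
    (h4 : b ≤ m + n) (h : (a < c ∧ c < b) ∨ (b < c ∧ c < a))
    (hac : U.br x y a c = 0) (hcb : U.br x y c b = 0) : U.br x y a b = 0 := by
  unfold br at *
  rw [sub_eq_zero] at *
  rw [U.nonsimple_def a b c h1 h2 h3 h4 h, sgn_split m x y a b c]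
  exact scomm_aux _ _ _ _ _ _ hac hcb

theorem br_simple (U : UqGl m n) (a c : ℕ) (h1 : 1 ≤ a) (h2 : a + 1 ≤ m + n) (h3 : 1 ≤ c)
    (k : ℕ) (h4 : c + k + 1 ≤ m + n) (h : a + 1 ≤ c ∨ c + k + 1 ≤ a) :
    U.br a (a + 1) (c + k + 1) c = 0 := by
  induction k with
  | zero =>
    have := U.EF_rel a c h1 h2 h3 h4
    rw [if_neg (by omega), zero_smul] at this
    exact this
  | succ k ih =>
    refine U.br_split a (a + 1) _ _ (c + k + 1) (by omega) (by omega) (by omega) (by omega)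
      (by omega) ?_ (ih (by omega) (by omega))
    have := U.EF_rel a (c + k + 1) h1 h2 (by omega) (by omega)
    rw [if_neg (by omega), zero_smul] at this
    exact this

theorem br_general (U : UqGl m n) (a c l : ℕ) (h1 : 1 ≤ a) (h3 : 1 ≤ c)
    (k : ℕ) (h2 : a + k + 1 ≤ m + n) (h4 : c + l + 1 ≤ m + n)
    (h : a + k + 1 ≤ c ∨ c + l + 1 ≤ a) :
    U.br (c + l + 1) c a (a + k + 1) = 0 := by
  induction k with
  | zero => exact U.br_symm _ _ _ _ (U.br_simple a c h1 h2 h3 l h4 h)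
  | succ k ih =>
    refine U.br_split _ _ _ _ (a + k + 1) (by omega) (by omega) (by omega) (by omega)
      (by omega) (ih (by omega) (by omega)) ?_
    exact U.br_symm _ _ _ _ (U.br_simple (a + k + 1) c (by omega) h2 h3 l h4 (by omega))

theorem br_disjoint (U : UqGl m n) (a b c d : ℕ) (h1 : 1 ≤ a) (h3 : 1 ≤ c)
    (hab : a < b) (hcd : c < d) (h2 : b ≤ m + n) (h4 : d ≤ m + n) (h : b ≤ c ∨ d ≤ a) :
    U.br d c a b = 0 := by
  obtain ⟨k, rfl⟩ := Nat.exists_eq_add_of_lt hab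
  obtain ⟨l, rfl⟩ := Nat.exists_eq_add_of_lt hcd
  exact U.br_general a c l h1 h3 k h2 h4 h

end UqGl

theorem stmt5 (m n : ℕ) (hm : 1 ≤ m) (hn : 1 ≤ n) (U : UqGl m n)
    (a b c : ℕ)
    (h1 : 1 ≤ a) (h2 : a ≤ m + n) (h3 : 1 ≤ b) (h4 : b ≤ m + n)
    (h5 : 1 ≤ c) (h6 : c ≤ m + n)
    (h : (a < c ∧ c < b) ∨ (b < c ∧ c < a)) :
    U.br c a c b = 0 ∧ U.br a c b c = 0 := by
  rcases h with ⟨hac, hcb⟩ | ⟨hbc, hca⟩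
  · exact ⟨U.br_disjoint c b a c h5 h1 hcb hac h4 h6 (Or.inr le_rfl),
      U.br_symm _ _ _ _ (U.br_disjoint a c c b h1 h5 hac hcb h6 h4 (Or.inl le_rfl))⟩
  · exact ⟨U.br_symm _ _ _ _ (U.br_disjoint c a b c h5 h3 hca hbc h2 h6 (Or.inr le_rfl)),
      U.br_disjoint b c c a h3 h5 hbc hca h6 h2 (Or.inl le_rfl)⟩

end
end

section
/- In U_q[gl(m|n)], for indices with c < a < d < b, the graded commutator satisfies [E^a_b, E^d_c] = Δ_d E^d_b E^a_c K_a^{-1} K_d. -/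
/-!
U_q[gl(m|n)]: the quantum superalgebra presented by generators and relations,
following Zhang (1993).  We work over the field ℚ(q) of rational functions.
-/

noncomputable section

namespace UqGl

variable {m n : ℕ}

lemma qi_ne (m a : ℕ) : qi m a ≠ 0 := by
  have h : qq ≠ 0 := RatFunc.X_ne_zero
  unfold qi; split_ifs
  · exact h
  · exact inv_ne_zero h

lemma Δq_ne : Δq ≠ 0 := by
  have h : qq ≠ 0 := RatFunc.X_ne_zero
  intro h0
  unfold Δq at h0
  have h1 : qq ^ 2 = 1 := by
    field_simp at h0
    linear_combination h0
  have h2 : (Polynomial.X ^ 2 : Polynomial ℚ) = 1 := by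
    apply RatFunc.algebraMap_injective ℚ
    rw [map_pow, RatFunc.algebraMap_X, map_one]
    exact h1
  have := congrArg Polynomial.natDegree h2
  simp at this

lemma Δi_eq (m a : ℕ) : Δi m a = qi m a - (qi m a)⁻¹ := by
  unfold Δi gr qi Δq; split_ifs <;> simp

lemma Δi_ne (m a : ℕ) : Δi m a ≠ 0 := by
  unfold Δi; exact mul_ne_zero (pow_ne_zero _ (by norm_num)) Δq_ne

/-- commuting with all simple lowering generators -/
lemma comm_lower_s16 (U : UqGl m n) (x : U.A) (s : ℕ) (hs : 1 ≤ s) (k : ℕ) :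
    s + k + 1 ≤ m + n → (∀ j, s ≤ j → j < s + k + 1 → Commute x (U.E (j+1) j)) →
    Commute x (U.E (s + k + 1) s) := by
  induction k with
  | zero => intro _ h; exact h s le_rfl (by omega)
  | succ k ih =>
    intro hb h
    rw [U.nonsimple_def (s + (k+1) + 1) s (s + k + 1) (by omega) hb hs (by omega) (by omega)]
    have i1 := ih (by omega) (fun j h1 h2 => h j h1 (by omega))
    have i2 := h (s + k + 1) (by omega) (by omega)
    exact (i2.mul_right i1).sub_right ((i1.mul_right i2).smul_right _)

lemma comm_raise_s16 (U : UqGl m n) (x : U.A) (s : ℕ) (hs : 1 ≤ s) (k : ℕ) :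
    s + k + 1 ≤ m + n → (∀ j, s ≤ j → j < s + k + 1 → Commute x (U.E j (j+1))) →
    Commute x (U.E s (s + k + 1)) := by
  induction k with
  | zero => intro _ h; exact h s le_rfl (by omega)
  | succ k ih =>
    intro hb h
    rw [U.nonsimple_def s (s + (k+1) + 1) (s + k + 1) hs (by omega) (by omega) hb (by omega)]
    have i1 := ih (by omega) (fun j h1 h2 => h j h1 (by omega))
    have i2 := h (s + k + 1) (by omega) (by omega)
    exact (i1.mul_right i2).sub_right ((i2.mul_right i1).smul_right _)

lemma comm_lower' (U : UqGl m n) (x : U.A) (s t : ℕ) (hs : 1 ≤ s) (hst : s < t)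
    (ht : t ≤ m + n) (h : ∀ j, s ≤ j → j < t → Commute x (U.E (j+1) j)) :
    Commute x (U.E t s) := by
  obtain ⟨k, rfl⟩ := Nat.exists_eq_add_of_lt hst
  exact comm_lower_s16 U x s hs k ht h

lemma comm_raise' (U : UqGl m n) (x : U.A) (s t : ℕ) (hs : 1 ≤ s) (hst : s < t)
    (ht : t ≤ m + n) (h : ∀ j, s ≤ j → j < t → Commute x (U.E j (j+1))) :
    Commute x (U.E s t) := by
  obtain ⟨k, rfl⟩ := Nat.exists_eq_add_of_lt hst
  exact comm_raise_s16 U x s hs k ht h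

lemma simple_comm (U : UqGl m n) (i j : ℕ) (hi : 1 ≤ i) (hi' : i + 1 ≤ m + n)
    (hj : 1 ≤ j) (hj' : j + 1 ≤ m + n) (hij : i ≠ j) :
    Commute (U.E i (i+1)) (U.E (j+1) j) := by
  have h := U.EF_rel i j hi hi' hj hj'
  have hs : sgn m i (i+1) (j+1) j = 1 := by
    unfold sgn gr; split_ifs <;> first | omega | norm_num
  rw [hs, if_neg hij, one_smul, zero_smul, sub_eq_zero] at h
  exact h

/-- raising and lowering generators with disjoint supports commute -/
lemma disj_comm (U : UqGl m n) (p r s t : ℕ) (hp : 1 ≤ p) (hpr : p < r) (hr : r ≤ m + n)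
    (hs : 1 ≤ s) (hst : s < t) (ht : t ≤ m + n) (h : t ≤ p ∨ r ≤ s) :
    Commute (U.E p r) (U.E t s) := by
  apply comm_lower' U _ s t hs hst ht
  intro j h1 h2
  apply Commute.symm
  apply comm_raise' U _ p r hp hpr hr
  intro i h3 h4
  exact (simple_comm U i j (by omega) (by omega) (by omega) (by omega) (by omega)).symm

/-- distant lowering generators commute -/
lemma low_comm (U : UqGl m n) (c a e d : ℕ) (hc : 1 ≤ c) (hca : c < a) (hae : a < e)
    (hed : e < d) (hd : d ≤ m + n) : Commute (U.E a c) (U.E d e) := by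
  apply comm_lower' U _ e d (by omega) hed hd
  intro j h1 h2
  apply Commute.symm
  apply comm_lower' U _ c a hc hca (by omega)
  intro i h3 h4
  exact U.EE_lower j i (by omega) (by omega) (by omega) (by omega) (by omega)

lemma alg_KE {F A : Type} [Field F] [Ring A] [Algebra F A] (k x y : A) (u v w : F)
    (h1 : k * x = u • (x * k)) (h2 : k * y = v • (y * k)) :
    k * (x * y - w • (y * x)) = (u * v) • ((x * y - w • (y * x)) * k) := by
  have e1 : k * (x * y) = (u * v) • (x * y * k) := by
    rw [← mul_assoc, h1, smul_mul_assoc, mul_assoc, h2, mul_smul_comm, smul_smul, mul_assoc]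
  have e2 : k * (y * x) = (u * v) • (y * x * k) := by
    rw [← mul_assoc, h2, smul_mul_assoc, mul_assoc, h1, mul_smul_comm, smul_smul, mul_assoc,
      mul_comm]
  rw [mul_sub, mul_smul_comm, e1, e2, sub_mul, smul_mul_assoc, smul_sub, smul_comm]

lemma K_lower (U : UqGl m n) (i : ℕ) (hi : 1 ≤ i) (hi' : i ≤ m + n) (s : ℕ) (hs : 1 ≤ s) (k : ℕ) :
    s + k + 1 ≤ m + n →
    U.K i * U.E (s+k+1) s = qi m i ^ (δℤ i (s+k+1) - δℤ i s) • (U.E (s+k+1) s * U.K i) := by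
  induction k with
  | zero => intro h; exact U.K_E_lower i s hi hi' hs h
  | succ k ih =>
    rw [show s + (k+1) + 1 = s + k + 1 + 1 by ring]
    intro hb
    rw [U.nonsimple_def (s + k + 1 + 1) s (s + k + 1) (by omega) hb hs (by omega) (by omega)]
    rw [alg_KE _ _ _ _ _ _ (U.K_E_lower i (s+k+1) hi hi' (by omega) (by omega)) (ih (by omega)),
      ← zpow_add₀ (qi_ne m i)]
    congr 2
    ring

lemma K_raise (U : UqGl m n) (i : ℕ) (hi : 1 ≤ i) (hi' : i ≤ m + n) (s : ℕ) (hs : 1 ≤ s) (k : ℕ) :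
    s + k + 1 ≤ m + n →
    U.K i * U.E s (s+k+1) = qi m i ^ (δℤ i s - δℤ i (s+k+1)) • (U.E s (s+k+1) * U.K i) := by
  induction k with
  | zero => intro h; exact U.K_E_raise i s hi hi' hs h
  | succ k ih =>
    rw [show s + (k+1) + 1 = s + k + 1 + 1 by ring]
    intro hb
    rw [U.nonsimple_def s (s + k + 1 + 1) (s + k + 1) hs (by omega) (by omega) hb (by omega)]
    rw [alg_KE _ _ _ _ _ _ (ih (by omega)) (U.K_E_raise i (s+k+1) hi hi' (by omega) (by omega)),
      ← zpow_add₀ (qi_ne m i)]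
    congr 2
    ring

lemma KE (U : UqGl m n) (i p r : ℕ) (hi : 1 ≤ i) (hi' : i ≤ m + n) (hp : 1 ≤ p)
    (hp' : p ≤ m + n) (hr : 1 ≤ r) (hr' : r ≤ m + n) (hpr : p ≠ r) :
    U.K i * U.E p r = qi m i ^ (δℤ i p - δℤ i r) • (U.E p r * U.K i) := by
  rcases lt_or_gt_of_ne hpr with h | h
  · obtain ⟨k, rfl⟩ := Nat.exists_eq_add_of_lt h
    exact K_raise U i hi hi' p hp k hr'
  · obtain ⟨k, rfl⟩ := Nat.exists_eq_add_of_lt h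
    exact K_lower U i hi hi' r hr k hp'

lemma KE_ne (U : UqGl m n) (i p r : ℕ) (hi : 1 ≤ i) (hi' : i ≤ m + n) (hp : 1 ≤ p)
    (hp' : p ≤ m + n) (hr : 1 ≤ r) (hr' : r ≤ m + n) (hpr : p ≠ r) (h1 : i ≠ p) (h2 : i ≠ r) :
    U.K i * U.E p r = U.E p r * U.K i := by
  have := KE U i p r hi hi' hp hp' hr hr' hpr
  simpa [δℤ, h1, h2] using this

lemma KE_left (U : UqGl m n) (p r : ℕ) (hp : 1 ≤ p)
    (hp' : p ≤ m + n) (hr : 1 ≤ r) (hr' : r ≤ m + n) (hpr : p ≠ r) :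
    U.K p * U.E p r = qi m p • (U.E p r * U.K p) := by
  have := KE U p p r hp hp' hp hp' hr hr' hpr
  simpa [δℤ, hpr] using this

lemma KE_right (U : UqGl m n) (p r : ℕ) (hp : 1 ≤ p)
    (hp' : p ≤ m + n) (hr : 1 ≤ r) (hr' : r ≤ m + n) (hpr : p ≠ r) :
    U.K r * U.E p r = (qi m r)⁻¹ • (U.E p r * U.K r) := by
  have := KE U r p r hr hr' hp hp' hr hr' hpr
  simpa [δℤ, hpr.symm] using this

lemma alg_inv {F A : Type} [Field F] [Ring A] [Algebra F A] (k l x : A) (u : F) (hu : u ≠ 0)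
    (h1 : k * l = 1) (h2 : l * k = 1) (h : k * x = u • (x * k)) :
    l * x = u⁻¹ • (x * l) := by
  have e : l * (k * x) * l = u • (l * x) := by
    rw [h, mul_smul_comm, smul_mul_assoc, mul_assoc, mul_assoc, h1, mul_one]
  rw [← mul_assoc, h2, one_mul] at e
  rw [e, smul_smul, inv_mul_cancel₀ hu, one_smul]

lemma alg_inv_comm {A : Type} [Ring A] (k l x : A)
    (h1 : k * l = 1) (h2 : l * k = 1) (h : k * x = x * k) :
    l * x = x * l := by
  calc l * x = l * (x * k) * l := by rw [mul_assoc, mul_assoc, h1, mul_one]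
    _ = x * l := by rw [← h, ← mul_assoc, h2, one_mul]

/-- base case: `X = E^a_{a+1}`, `Q = E^{a+1}_a`, `P = E^a_c`. -/
lemma alg_base {F A : Type} [Field F] [Ring A] [Algebra F A] (X Q P ka la kd ld : A) (q s D : F)
    (hq : D ≠ 0) (hD : D = q - q⁻¹) (hXP : X * P = P * X)
    (hH : X * Q - s • (Q * X) = D⁻¹ • (ka * ld - la * kd))
    (h1 : ka * P = q • (P * ka)) (h2 : la * P = q⁻¹ • (P * la))
    (h3 : kd * P = P * kd) (h4 : ld * P = P * ld) :
    X * (Q * P - q • (P * Q)) - s • ((Q * P - q • (P * Q)) * X) = P * la * kd := by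
  have e : X * (Q * P - q • (P * Q)) - s • ((Q * P - q • (P * Q)) * X)
      = (X * Q - s • (Q * X)) * P - q • (P * (X * Q - s • (Q * X))) := by
    have t1 : X * (P * Q) = P * (X * Q) := by rw [← mul_assoc, hXP, mul_assoc]
    have t2 : Q * X * P = Q * P * X := by rw [mul_assoc, hXP, mul_assoc]
    simp only [mul_sub, sub_mul, smul_mul_assoc, mul_smul_comm, t1, t2]
    simp only [mul_assoc]
    module
  have t3 : (ka * ld - la * kd) * P = q • (P * (ka * ld)) - q⁻¹ • (P * (la * kd)) := by
    rw [sub_mul, mul_assoc, h4, ← mul_assoc, h1, mul_assoc la, h3, ← mul_assoc la, h2]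
    simp only [smul_mul_assoc, mul_assoc]
  rw [e, hH, smul_mul_assoc, t3, mul_smul_comm, mul_sub, mul_assoc]
  have : D⁻¹ * (q - q⁻¹) = 1 := by rw [← hD, inv_mul_cancel₀ hq]
  calc _ = (D⁻¹ * (q - q⁻¹)) • (P * (la * kd)) := by module
    _ = _ := by rw [this, one_smul]

/-- `X = E^a_e`, `Q = E^d_e`, `P = E^e_c`, `W = [X,P]`. -/
lemma alg_mid {F A : Type} [Field F] [Ring A] [Algebra F A] (X Q P W : A) (q s : F) (hq : q ≠ 0)
    (hXQ : X * Q = Q * X) (hW : X * P - s • (P * X) = W) (hWQ : W * Q = q⁻¹ • (Q * W)) :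
    X * (Q * P - q • (P * Q)) - s • ((Q * P - q • (P * Q)) * X) = 0 := by
  have e : X * (Q * P - q • (P * Q)) - s • ((Q * P - q • (P * Q)) * X)
      = Q * (X * P - s • (P * X)) - q • ((X * P - s • (P * X)) * Q) := by
    have t1 : X * (Q * P) = Q * (X * P) := by rw [← mul_assoc, hXQ, mul_assoc]
    simp only [mul_sub, sub_mul, smul_mul_assoc, mul_smul_comm, t1, mul_assoc]
    rw [hXQ]
    module
  rw [e, hW, hWQ, smul_smul, mul_inv_cancel₀ hq, one_smul, sub_self]

/-- derivation rule -/
lemma alg_step {F A : Type} [Field F] [Ring A] [Algebra F A] (X Y Z V : A) (r s t : F)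
    (hXZ : X * Z - s • (Z * X) = 0) (hV : Y * Z - t • (Z * Y) = V) :
    (X * Y - r • (Y * X)) * Z - (s * t) • (Z * (X * Y - r • (Y * X)))
      = X * V - (r * s) • (V * X) := by
  rw [sub_eq_zero] at hXZ
  have t1 : X * (Z * Y) = s • (Z * (X * Y)) := by
    rw [← mul_assoc, hXZ, smul_mul_assoc, mul_assoc]
  rw [← hV]
  simp only [mul_sub, sub_mul, smul_mul_assoc, mul_smul_comm, t1, mul_assoc, hXZ]
  module

lemma alg_final {F A : Type} [Field F] [Ring A] [Algebra F A] (X Y Z W : A) (q s : F)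
    (hYZ : Y * Z = Z * Y) (hW : X * Z - s • (Z * X) = W) (hWY : W * Y = q • (Y * W)) :
    (X * Y - q⁻¹ • (Y * X)) * Z - s • (Z * (X * Y - q⁻¹ • (Y * X)))
      = (q - q⁻¹) • (Y * W) := by
  have t1 : Z * (Y * X) = Y * (Z * X) := by rw [← mul_assoc, ← hYZ, mul_assoc]
  have e : (X * Y - q⁻¹ • (Y * X)) * Z - s • (Z * (X * Y - q⁻¹ • (Y * X)))
      = (X * Z - s • (Z * X)) * Y - q⁻¹ • (Y * (X * Z - s • (Z * X))) := by
    simp only [mul_sub, sub_mul, smul_mul_assoc, mul_smul_comm, t1, mul_assoc]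
    rw [hYZ]
    module
  rw [e, hW, hWY]
  module

lemma L1_base (U : UqGl m n) (c a : ℕ) (hc : 1 ≤ c) (hca : c < a) (ha : a + 1 ≤ m + n) :
    U.br a (a+1) (a+1) c = U.E a c * U.Kinv a * U.K (a+1) := by
  unfold br
  rw [U.nonsimple_def (a+1) c a (by omega) (by omega) hc (by omega) (by omega),
    if_pos (by omega)]
  have hs : sgn m a (a+1) (a+1) c = sgn m a (a+1) (a+1) a := by
    unfold sgn gr; split_ifs <;> first | omega | norm_num
  rw [hs]
  have hH := U.EF_rel a a (by omega) ha (by omega) ha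
  rw [if_pos rfl] at hH
  have hK := KE_left U a c (by omega) (by omega) hc (by omega) (by omega)
  have hKd := KE_ne U (a+1) a c (by omega) (by omega) (by omega) (by omega) hc (by omega)
    (by omega) (by omega) (by omega)
  exact alg_base _ _ _ _ _ _ _ _ _ _ (Δi_ne m a) (Δi_eq m a)
    (disj_comm U a (a+1) c a (by omega) (by omega) ha hc hca (by omega) (by omega)) hH hK
    (alg_inv _ _ _ _ (qi_ne m a) (U.K_Kinv a (by omega) (by omega))
      (U.Kinv_K a (by omega) (by omega)) hK) hKd
    (alg_inv_comm _ _ _ (U.K_Kinv (a+1) (by omega) (by omega))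
      (U.Kinv_K (a+1) (by omega) (by omega)) hKd)

lemma L1 (U : UqGl m n) (c a : ℕ) (hc : 1 ≤ c) (hca : c < a) (k : ℕ) :
    a + k + 1 ≤ m + n →
    U.br a (a+k+1) (a+k+1) c = U.E a c * U.Kinv a * U.K (a+k+1) := by
  induction k with
  | zero => intro h; exact L1_base U c a hc hca h
  | succ k ih =>
    intro hb
    have ih := ih (by omega)
    have hV := L1_base U c (a+k+1) hc (by omega) (by omega)
    rw [show a + (k+1) + 1 = a + k + 1 + 1 by ring] at hb ⊢
    generalize he : a + k + 1 = e at *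
    have hXZ : U.br a e (e+1) c = 0 := by
      unfold br at ih ⊢
      have hs : sgn m a e (e+1) c = sgn m a e e c := by
        unfold sgn gr; split_ifs <;> first | omega | norm_num
      rw [hs, U.nonsimple_def (e+1) c e (by omega) (by omega) hc (by omega) (by omega),
        if_pos (by omega)]
      refine alg_mid _ _ _ _ _ _ (qi_ne m e)
        (disj_comm U a e e (e+1) (by omega) (by omega) (by omega) (by omega) (by omega)
          (by omega) (by omega)) ih ?_
      have k1 := KE_right U (e+1) e (by omega) (by omega) (by omega) (by omega) (by omega)
      have k2 := alg_inv_comm _ _ _ (U.K_Kinv a (by omega) (by omega))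
        (U.Kinv_K a (by omega) (by omega))
        (KE_ne U a (e+1) e (by omega) (by omega) (by omega) (by omega) (by omega) (by omega)
        (by omega) (by omega) (by omega))
      have k3 := (low_comm U c a e (e+1) hc hca (by omega) (by omega) (by omega)).eq
      rw [mul_assoc, k1, mul_smul_comm, ← mul_assoc, mul_assoc (U.E a c), k2,
        ← mul_assoc (U.E a c), k3]
      simp only [mul_assoc]
    unfold br at ih hV hXZ ⊢
    have hs : sgn m a (e+1) (e+1) c = sgn m a e (e+1) c * sgn m e (e+1) (e+1) c := by
      unfold sgn gr; split_ifs <;> first | omega | norm_num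
    have hs2 : sgn m a e (e+1) c = sgn m a e e c := by
      unfold sgn gr; split_ifs <;> first | omega | norm_num
    rw [hs, U.nonsimple_def a (e+1) e (by omega) (by omega) (by omega) (by omega) (by omega),
      if_neg (by omega), alg_step _ _ _ _ _ _ _ hXZ hV, hs2]
    have k1 := alg_inv _ _ _ _ (inv_ne_zero (qi_ne m e)) (U.K_Kinv e (by omega) (by omega))
        (U.Kinv_K e (by omega) (by omega))
        (KE_right U a e (by omega) (by omega) (by omega) (by omega) (by omega))
    have k2 := KE_ne U (e+1) a e (by omega) (by omega) (by omega) (by omega) (by omega) (by omega)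
        (by omega) (by omega) (by omega)
    have k3 : U.E e c * U.Kinv e * U.K (e+1) * U.E a e
        = qi m e • (U.E e c * U.E a e * U.Kinv e * U.K (e+1)) := by
      rw [mul_assoc, k2, ← mul_assoc, mul_assoc (U.E e c), k1]
      simp only [mul_smul_comm, smul_mul_assoc, inv_inv, mul_assoc]
    have k4 : U.E a c * U.Kinv a * U.K (e+1)
        = (U.E a c * U.Kinv a * U.K e) * (U.Kinv e * U.K (e+1)) := by
      rw [mul_assoc _ (U.K e), ← mul_assoc (U.K e), U.K_Kinv e (by omega) (by omega), one_mul]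
    rw [k3, k4, ← ih, smul_smul, sub_mul, smul_mul_assoc]
    have : (qi m e)⁻¹ * sgn m a e e c * qi m e = sgn m a e e c := by
      field_simp [qi_ne m e]
    rw [this]
    simp only [mul_assoc]

end UqGl

theorem stmt16 (m n : ℕ) (hm : 1 ≤ m) (hn : 1 ≤ n) (U : UqGl m n)
    (a b c d : ℕ)
    (h1 : 1 ≤ a) (h2 : a ≤ m + n) (h3 : 1 ≤ b) (h4 : b ≤ m + n)
    (h5 : 1 ≤ c) (h6 : c ≤ m + n) (h7 : 1 ≤ d) (h8 : d ≤ m + n)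
    (hca : c < a) (had : a < d) (hdb : d < b) :
    U.br a b d c = Δi m d • (U.E d b * U.E a c * U.Kinv a * U.K d) := by
  have hW : U.br a d d c = U.E a c * U.Kinv a * U.K d := by
    obtain ⟨k, rfl⟩ := Nat.exists_eq_add_of_lt had
    exact UqGl.L1 U c a h5 hca k h8
  unfold UqGl.br at hW ⊢
  have hs : sgn m a b d c = sgn m a d d c := by
    unfold sgn gr; split_ifs <;> first | omega | norm_num
  rw [hs, U.nonsimple_def a b d h1 h2 h3 h4 (by omega), if_neg (by omega), UqGl.Δi_eq]
  have k1 := UqGl.KE_left U d b h7 h8 h3 h4 (by omega)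
  have k2 := UqGl.alg_inv_comm _ _ _ (U.K_Kinv a h1 h2) (U.Kinv_K a h1 h2)
    (UqGl.KE_ne U a d b h1 h2 h7 h8 h3 h4 (by omega) (by omega) (by omega))
  have k3 := (UqGl.disj_comm U d b c a h7 hdb h4 h5 hca h2 (by omega)).eq
  rw [UqGl.alg_final _ _ _ _ (qi m d) _
    (UqGl.disj_comm U d b c d h7 hdb h4 h5 (by omega) h8 (by omega)).eq hW ?_]
  · simp only [mul_assoc]
  · rw [mul_assoc, k1, mul_smul_comm, ← mul_assoc, mul_assoc (U.E a c), k2,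
      ← mul_assoc (U.E a c), ← k3]
    simp only [mul_assoc]

end
end
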